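/- arXiv:math/0308141 — 3 statements merged into one kernel-verified Lean document; each statement's English description precedes it below -/
import Mathlib

section
/- Let V be a finite-dimensional vector space over a field and N : V → V a nilpotent linear endomorphism. Then there exists at most one increasing filtration M indexed by ℤ (with M_k = 0 for k sufficiently small and M_k = V for k sufficiently large) such that N(M_k) ⊆ M_{k-2} for all k and, for every k ≥ 0, the map induced by N^k from Gr^M_k V = M_k/M_{k-1} to Gr^M_{-k} V = M_{-k}/M_{-k-1} is an isomorphism. -/
open Module

/-- `M` is a monodromy filtration for the nilpotent operator `N`: it is an increasing
filtration, separated (`M k = ⊥` for `k ≪ 0`), exhaustive (`M k = ⊤` for `k ≫ 0`),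
satisfies `N (M k) ⊆ M (k - 2)`, and for every `k ≥ 0` the map induced by `N ^ k`
from `Gr^M_k = M k / M (k-1)` to `Gr^M_{-k} = M (-k) / M (-k-1)` is injective and
surjective (i.e. an isomorphism). -/
def IsMonodromyFiltration {K V : Type*} [Field K] [AddCommGroup V] [Module K V]
    (N : V →ₗ[K] V) (M : ℤ → Submodule K V) : Prop :=
  Monotone M ∧
  (∃ a : ℤ, ∀ k ≤ a, M k = ⊥) ∧
  (∃ b : ℤ, ∀ k, b ≤ k → M k = ⊤) ∧
  (∀ k : ℤ, ∀ x ∈ M k, N x ∈ M (k - 2)) ∧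
  (∀ k : ℕ,
    (∀ x ∈ M (k : ℤ), (N ^ k) x ∈ M (-(k : ℤ) - 1) → x ∈ M ((k : ℤ) - 1)) ∧
    (∀ y ∈ M (-(k : ℤ)), ∃ x ∈ M (k : ℤ), (N ^ k) x - y ∈ M (-(k : ℤ) - 1)))

theorem IsMonodromyFiltration.pow_mem {K V : Type*} [Field K] [AddCommGroup V] [Module K V]
    {N : V →ₗ[K] V} {M : ℤ → Submodule K V} (hM : IsMonodromyFiltration N M) (n : ℕ) :
    ∀ (k : ℤ), ∀ x ∈ M k, (N ^ n) x ∈ M (k - 2 * n) := by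
  induction n with
  | zero => intro k x hx; simpa using hx
  | succ n ih =>
    intro k x hx
    rw [pow_succ']
    have h := hM.2.2.2.1 _ _ (ih k x hx)
    have e : k - 2 * (n : ℤ) - 2 = k - 2 * ((n + 1 : ℕ) : ℤ) := by push_cast; ring
    rw [e] at h
    exact h

theorem IsMonodromyFiltration.step {K V : Type*} [Field K] [AddCommGroup V] [Module K V]
    {N : V →ₗ[K] V} {M M' : ℤ → Submodule K V} (hM : IsMonodromyFiltration N M)
    (hM' : IsMonodromyFiltration N M') (m : ℕ)
    (h1 : M (m : ℤ) = M' (m : ℤ)) (h2 : M (-(m : ℤ) - 1) = M' (-(m : ℤ) - 1)) :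
    M ((m : ℤ) - 1) ≤ M' ((m : ℤ) - 1) ∧ M (-(m : ℤ)) ≤ M' (-(m : ℤ)) := by
  constructor
  · intro x hx
    refine (hM'.2.2.2.2 m).1 x (h1 ▸ hM.1 (by omega) hx) ?_
    rw [← h2]
    have h := hM.pow_mem m _ x hx
    have e : (m : ℤ) - 1 - 2 * m = -(m : ℤ) - 1 := by ring
    rwa [e] at h
  · intro y hy
    obtain ⟨x, hx, hxy⟩ := (hM.2.2.2.2 m).2 y hy
    rw [h1] at hx
    rw [h2] at hxy
    have h := hM'.pow_mem m _ x hx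
    have e : (m : ℤ) - 2 * m = -(m : ℤ) := by ring
    rw [e] at h
    have h3 := Submodule.sub_mem _ h (hM'.1 (by omega : -(m : ℤ) - 1 ≤ -(m : ℤ)) hxy)
    simpa using h3

/-- Uniqueness of the monodromy filtration of a nilpotent endomorphism of a
finite-dimensional vector space. -/
theorem monodromy_filtration_unique {K V : Type*} [Field K] [AddCommGroup V] [Module K V]
    [FiniteDimensional K V] (N : V →ₗ[K] V) (hN : IsNilpotent N)
    (M M' : ℤ → Submodule K V)
    (hM : IsMonodromyFiltration N M) (hM' : IsMonodromyFiltration N M') :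
    M = M' := by
  obtain ⟨a, ha⟩ := hM.2.1
  obtain ⟨a', ha'⟩ := hM'.2.1
  obtain ⟨b, hb⟩ := hM.2.2.1
  obtain ⟨b', hb'⟩ := hM'.2.2.1
  have key : ∀ d n : ℕ, a.natAbs + a'.natAbs + b.natAbs + b'.natAbs ≤ n + d →
      M (n : ℤ) = M' (n : ℤ) ∧ M (-(n : ℤ) - 1) = M' (-(n : ℤ) - 1) := by
    intro d
    induction d with
    | zero =>
      intro n hn
      rw [hb n (by omega), hb' n (by omega), ha _ (by omega), ha' _ (by omega)]
      exact ⟨rfl, rfl⟩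
    | succ d ih =>
      intro n hn
      obtain ⟨h1, h2⟩ := ih (n + 1) (by omega)
      have s := hM.step hM' (n + 1) h1 h2
      have s' := hM'.step hM (n + 1) h1.symm h2.symm
      have e1 : ((n + 1 : ℕ) : ℤ) - 1 = n := by push_cast; ring
      have e2 : -((n + 1 : ℕ) : ℤ) = -(n : ℤ) - 1 := by push_cast; ring
      rw [e1, e2] at s s'
      exact ⟨le_antisymm s.1 s'.1, le_antisymm s.2 s'.2⟩
  funext k
  rcases le_or_gt 0 k with hk | hk
  · have h := (key _ k.toNat (Nat.le_add_left _ _)).1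
    rwa [Int.toNat_of_nonneg hk] at h
  · have h := (key _ (-k - 1).toNat (Nat.le_add_left _ _)).2
    rw [Int.toNat_of_nonneg (by omega)] at h
    have e : -(-k - 1) - 1 = k := by ring
    rwa [e] at h
end

section
/- Let V be a finite-dimensional vector space over a field and N : V → V a nilpotent linear endomorphism. Then there exists an increasing filtration M (the monodromy filtration) with M_k = 0 for k ≪ 0, M_k = V for k ≫ 0, N(M_k) ⊆ M_{k-2} for all k, and such that for every k ≥ 0 the map induced by N^k gives an isomorphism Gr^M_k V ≅ Gr^M_{-k} V. -/
open Module

/-- Explicit formula: `M k` is the sum over `j` of `N ^ j (ker N ^ (k + 2 j + 1))`. -/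
def monoFil {K V : Type*} [Field K] [AddCommGroup V] [Module K V]
    (N : V →ₗ[K] V) (k : ℤ) : Submodule K V :=
  ⨆ j : ℕ, (LinearMap.ker (N ^ (k + 2 * j + 1).toNat)).map (N ^ j)

section
variable {K V : Type*} [Field K] [AddCommGroup V] [Module K V] (N : V →ₗ[K] V)

theorem pow_zero_of_le {a b : ℕ} (h : a ≤ b) {x : V} (hx : (N ^ a) x = 0) : (N ^ b) x = 0 := by
  obtain ⟨c, rfl⟩ := Nat.exists_eq_add_of_le' h
  rw [pow_add, Module.End.mul_apply, hx, map_zero]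

theorem mem_monoFil {k : ℤ} (j : ℕ) {x : V} (e : ℕ) (he : (e : ℤ) ≤ k + 2 * j + 1)
    (hx : (N ^ e) x = 0) : (N ^ j) x ∈ monoFil N k := by
  refine Submodule.mem_iSup_of_mem j (Submodule.mem_map_of_mem ?_)
  exact pow_zero_of_le N (by omega) hx

theorem monoFil_le {k : ℤ} {P : Submodule K V}
    (h : ∀ (j e : ℕ) (x : V), e = (k + 2 * j + 1).toNat → (N ^ e) x = 0 → (N ^ j) x ∈ P) :
    monoFil N k ≤ P := by
  refine iSup_le fun j => ?_
  rintro _ ⟨x, hx, rfl⟩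
  exact h j _ x rfl hx

theorem monoFil_mono : Monotone (monoFil N) := by
  intro a b hab
  refine monoFil_le N fun j e x he hx => ?_
  by_cases h0 : e = 0
  · subst h0
    have : x = 0 := by simpa using hx
    simp [this]
  · exact mem_monoFil N j e (by omega) hx

theorem monoFil_map (k : ℤ) : monoFil N k ≤ (monoFil N (k - 2)).comap N := by
  refine monoFil_le N fun j e x he hx => ?_
  rw [Submodule.mem_comap, ← Module.End.mul_apply, ← pow_succ']
  by_cases h0 : e = 0
  · subst h0
    have : x = 0 := by simpa using hx
    simp [this]
  · exact mem_monoFil N (j + 1) e (by push_cast; omega) hx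

theorem monoFil_surj (k : ℕ) : monoFil N (-(k : ℤ)) ≤ (monoFil N k).map (N ^ k) := by
  refine monoFil_le N fun j e x he hx => ?_
  by_cases h : k ≤ j
  · obtain ⟨i, rfl⟩ := Nat.exists_eq_add_of_le h
    rw [pow_add, Module.End.mul_apply]
    exact Submodule.mem_map_of_mem (mem_monoFil N i e (by push_cast at he; omega) hx)
  · rw [pow_zero_of_le N (by omega) hx]
    exact zero_mem _
end

/-- Existence of the monodromy filtration of a nilpotent endomorphism of a
finite-dimensional vector space. -/
theorem monodromy_filtration_exists {K V : Type*} [Field K] [AddCommGroup V] [Module K V]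
    [FiniteDimensional K V] (N : V →ₗ[K] V) (hN : IsNilpotent N) :
    ∃ M : ℤ → Submodule K V, IsMonodromyFiltration N M := by 
  obtain ⟨n, hn⟩ := hN
  have hn' : ∀ x, (N ^ n) x = 0 := fun x => by rw [hn]; rfl
  refine ⟨monoFil N, monoFil_mono N, ⟨-n, fun k hk => ?_⟩, ⟨n, fun k hk => ?_⟩,
    fun k x hx => monoFil_map N k hx, fun k => ⟨fun x _ hx => ?_, fun y hy => ?_⟩⟩
  · refine le_bot_iff.1 (monoFil_le N fun j e x he hx => ?_)
    rw [Submodule.mem_bot]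
    by_cases h : n ≤ j
    · exact pow_zero_of_le N h (hn' x)
    · exact pow_zero_of_le N (by omega) hx
  · refine eq_top_iff.2 fun x _ => ?_
    have := mem_monoFil N (k := k) 0 n (by push_cast; omega) (hn' x)
    simpa using this
  · have h1 : -(k : ℤ) - 1 = -((k + 1 : ℕ) : ℤ) := by push_cast; ring
    rw [h1] at hx
    obtain ⟨w, hw, hwx⟩ := monoFil_surj N (k + 1) hx
    have h2 : N w ∈ monoFil N ((k : ℤ) - 1) := by
      have := monoFil_map N _ hw
      have h3 : ((k + 1 : ℕ) : ℤ) - 2 = (k : ℤ) - 1 := by push_cast; ring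
      rwa [h3] at this
    have h4 : (N ^ k) (x - N w) = 0 := by
      rw [map_sub, ← hwx, pow_succ, Module.End.mul_apply, sub_self]
    have h5 := mem_monoFil N (k := (k : ℤ) - 1) 0 k (by push_cast; omega) h4
    have h6 := add_mem h5 h2
    simpa using h6
  · obtain ⟨x, hx, rfl⟩ := monoFil_surj N k hy
    exact ⟨x, hx, by simp⟩
end

section
/- Let V, V' be finite-dimensional vector spaces with nilpotent endomorphisms N, N' and monodromy filtrations M, M'. If f : V → V' is a linear map with f ∘ N = N' ∘ f, then f(M_k V) ⊆ M'_k V' for all k. -/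
open Module

theorem mono_pow_mem {K V : Type*} [Field K] [AddCommGroup V] [Module K V]
    {N : V →ₗ[K] V} {M : ℤ → Submodule K V} (hM : IsMonodromyFiltration N M) (j : ℕ) :
    ∀ (k : ℤ), ∀ x ∈ M k, (N ^ j) x ∈ M (k - 2 * j) := by
  obtain ⟨-, -, -, hN, -⟩ := hM
  induction j with
  | zero => intro k x hx; simpa using hx
  | succ j ih =>
    intro k x hx
    have h := hN _ _ (ih k x hx)
    rw [pow_succ', Module.End.mul_apply]
    convert h using 2
    push_cast
    ring

/-- If `N ^ (m+1) z = 0` then `z ∈ M m`. -/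
theorem mono_ker_mem {K V : Type*} [Field K] [AddCommGroup V] [Module K V]
    {N : V →ₗ[K] V} {M : ℤ → Submodule K V} (hM : IsMonodromyFiltration N M) (m : ℕ)
    (z : V) (hz : (N ^ (m + 1)) z = 0) : z ∈ M (m : ℤ) := by
  obtain ⟨hmono, -, ⟨b, hb⟩, hN, hG⟩ := hM
  have key : ∀ d : ℕ, z ∈ M ((m : ℤ) + d) → z ∈ M (m : ℤ) := by
    intro d
    induction d with
    | zero => intro h; simpa using h
    | succ d ih =>
      intro h
      apply ih
      have h1 := (hG (m + 1 + d)).1 z (by convert h using 2; push_cast; ring) (by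
        rw [add_comm (m + 1) d, pow_add, Module.End.mul_apply, hz, map_zero]
        exact Submodule.zero_mem _)
      convert h1 using 2
      push_cast
      ring
  apply key (b - m).toNat
  rw [hb _ (by omega)]
  exact Submodule.mem_top

/-- `M (-j) = N ^ j (M j)`. -/
theorem mono_neg_exists {K V : Type*} [Field K] [AddCommGroup V] [Module K V]
    {N : V →ₗ[K] V} {M : ℤ → Submodule K V} (hM : IsMonodromyFiltration N M) (j : ℕ) :
    ∀ y ∈ M (-(j : ℤ)), ∃ x ∈ M (j : ℤ), (N ^ j) x = y := by
  obtain ⟨hmono, ⟨a, ha⟩, -, hN, hG⟩ := hM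
  have key : ∀ d j : ℕ, -a ≤ (j : ℤ) + d →
      ∀ y ∈ M (-(j : ℤ)), ∃ x ∈ M (j : ℤ), (N ^ j) x = y := by
    intro d
    induction d with
    | zero =>
      intro j hj y hy
      rw [ha _ (by push_cast at hj; omega), Submodule.mem_bot] at hy
      exact ⟨0, Submodule.zero_mem _, by simp [hy]⟩
    | succ d ih =>
      intro j hj y hy
      obtain ⟨x, hx, hxy⟩ := (hG j).2 y hy
      obtain ⟨w, hw, hwy⟩ := ih (j + 1) (by push_cast at hj ⊢; omega) ((N ^ j) x - y)
        (by convert hxy using 2; push_cast; ring)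
      have hNw : N w ∈ M (j : ℤ) := hmono (by push_cast; omega) (hN _ _ hw)
      refine ⟨x - N w, Submodule.sub_mem _ hx hNw, ?_⟩
      rw [pow_succ, Module.End.mul_apply] at hwy
      rw [map_sub, hwy]
      abel
  exact key (-a).toNat j (by omega)

/-- A linear map intertwining two nilpotent operators is compatible with the
monodromy filtrations: `f (M_k V) ⊆ M'_k V'`. -/
theorem monodromy_filtration_map {K V V' : Type*} [Field K] [AddCommGroup V] [Module K V]
    [AddCommGroup V'] [Module K V'] [FiniteDimensional K V] [FiniteDimensional K V']
    (N : V →ₗ[K] V) (N' : V' →ₗ[K] V') (hN : IsNilpotent N) (hN' : IsNilpotent N')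
    (M : ℤ → Submodule K V) (M' : ℤ → Submodule K V')
    (hM : IsMonodromyFiltration N M) (hM' : IsMonodromyFiltration N' M')
    (f : V →ₗ[K] V') (hf : f ∘ₗ N = N' ∘ₗ f) :
    ∀ k : ℤ, (M k).map f ≤ M' k := by
  have hfp : ∀ (j : ℕ) (x : V), f ((N ^ j) x) = (N' ^ j) (f x) := by
    intro j
    induction j with
    | zero => intro x; simp
    | succ j ih =>
      intro x
      rw [pow_succ, pow_succ, Module.End.mul_apply, Module.End.mul_apply, ih]
      exact congrArg _ (LinearMap.congr_fun hf x)
  obtain ⟨b, hb⟩ := hM'.2.2.1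
  have hpos : ∀ d k : ℕ, b ≤ (k : ℤ) + d → ∀ x ∈ M (k : ℤ), f x ∈ M' (k : ℤ) := by
    intro d
    induction d with
    | zero =>
      intro k hk x _
      rw [hb _ (by push_cast at hk; omega)]
      exact Submodule.mem_top
    | succ d ih =>
      intro k hk x hx
      have h1 := mono_pow_mem hM (k + 1) k x hx
      obtain ⟨w, hw, hwx⟩ := mono_neg_exists hM (k + 2) ((N ^ (k + 1)) x)
        (by convert h1 using 2; push_cast; ring)
      have h2 := ih (k + 2) (by push_cast at hk ⊢; omega) w hw
      have h3 : f (N w) ∈ M' (k : ℤ) := by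
        have h4 := mono_pow_mem hM' 1 _ _ h2
        rw [← hfp, pow_one] at h4
        convert h4 using 2
        push_cast
        ring
      have h5 : f (x - N w) ∈ M' (k : ℤ) := by
        apply mono_ker_mem hM'
        rw [← hfp, map_sub, ← hwx, pow_succ N (k + 1), Module.End.mul_apply, sub_self, map_zero]
      have h6 := Submodule.add_mem _ h5 h3
      rwa [← map_add, sub_add_cancel] at h6
  rintro k _ ⟨x, hx, rfl⟩
  rcases le_total 0 k with hk | hk
  · lift k to ℕ using hk
    exact hpos (b - k).toNat k (by omega) x hx
  · obtain ⟨j, rfl⟩ : ∃ j : ℕ, k = -(j : ℤ) := ⟨(-k).toNat, by omega⟩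
    obtain ⟨w, hw, rfl⟩ := mono_neg_exists hM j x hx
    have h := mono_pow_mem hM' j _ _ (hpos (b - j).toNat j (by omega) w hw)
    rw [hfp]
    convert h using 2
    ring
end
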